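/- Let p be a prime, K a field of characteristic p, and d, h natural numbers with h ≥ 3, d = h·p and p dividing h. Let σ be a permutation of {1,…,d} whose cycle type consists of exactly h cycles of length p (so σ has no fixed points), and let g denote the induced action of σ on the fully deleted permutation module V for S_d over K. Then for every natural number k, the dimension over K of the kernel of (g − id)^k equals (h−2)·min(k,p) + 2·min(k,p−1); equivalently, g has Jordan form [J_p^{h−2}, J_{p−1}^2] on V. -/

import Mathlib

/-- The sum-of-coordinates functional on `K^d`. -/
def sumFunctional (K : Type*) [Field K] (d : ℕ) : (Fin d → K) →ₗ[K] K where
  toFun v := ∑ i, v i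
  map_add' u v := by simp [Finset.sum_add_distrib]
  map_smul' c v := by simp [Finset.mul_sum]

/-- The zero-sum submodule `U` of the permutation module `K^d`. -/
def zeroSum (K : Type*) [Field K] (d : ℕ) : Submodule K (Fin d → K) :=
  LinearMap.ker (sumFunctional K d)

/-- The submodule `W` of constant vectors in `K^d`. -/
def constSub (K : Type*) [Field K] (d : ℕ) : Submodule K (Fin d → K) :=
  Submodule.span K {(fun _ => 1 : Fin d → K)}

/-- `U ∩ W`, viewed as a submodule of `U`. -/
def UW (K : Type*) [Field K] (d : ℕ) : Submodule K (zeroSum K d) :=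
  (zeroSum K d ⊓ constSub K d).comap (zeroSum K d).subtype

/-- The fully deleted permutation module `V = U/(U ∩ W)` for `S_d` over `K`. -/
abbrev deletedPermModule (K : Type*) [Field K] (d : ℕ) :=
  zeroSum K d ⧸ UW K d

/-- The linear action of a permutation `σ` on `K^d`, `v ↦ v ∘ σ`. -/
def permMap (K : Type*) [Field K] {d : ℕ} (σ : Equiv.Perm (Fin d)) :
    (Fin d → K) →ₗ[K] (Fin d → K) :=
  LinearMap.funLeft K K σ

lemma permMap_mem_zeroSum (K : Type*) [Field K] {d : ℕ} (σ : Equiv.Perm (Fin d))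
    {v : Fin d → K} (hv : v ∈ zeroSum K d) : permMap K σ v ∈ zeroSum K d := by
  simp only [zeroSum, LinearMap.mem_ker] at hv ⊢
  simpa [permMap, sumFunctional, LinearMap.funLeft, Equiv.sum_comp σ v] using hv

lemma permMap_mem_constSub (K : Type*) [Field K] {d : ℕ} (σ : Equiv.Perm (Fin d))
    {v : Fin d → K} (hv : v ∈ constSub K d) : permMap K σ v ∈ constSub K d := by
  rw [constSub, Submodule.mem_span_singleton] at hv ⊢
  obtain ⟨c, rfl⟩ := hv
  exact ⟨c, rfl⟩

/-- The endomorphism of the fully deleted permutation module induced by a permutation. -/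
def permEnd (K : Type*) [Field K] {d : ℕ} (σ : Equiv.Perm (Fin d)) :
    deletedPermModule K d →ₗ[K] deletedPermModule K d :=
  Submodule.mapQ (UW K d) (UW K d)
    ((permMap K σ).restrict (fun _ hv => permMap_mem_zeroSum K σ hv))
    (by
      rintro ⟨v, hvU⟩ hv
      simp only [UW, Submodule.mem_comap, Submodule.mem_inf, Submodule.coe_subtype,
        LinearMap.restrict_apply] at hv ⊢
      exact ⟨permMap_mem_zeroSum K σ hv.1, permMap_mem_constSub K σ hv.2⟩)

open Module

/-- The kernel of `f ^ (a + b)` is at most as large as those of `f ^ a` and `f ^ b` together. -/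
lemma finrank_ker_pow_add_le {K M : Type*} [Field K] [AddCommGroup M] [Module K M]
    [FiniteDimensional K M] (f : M →ₗ[K] M) (a b : ℕ) :
    finrank K (LinearMap.ker (f ^ (a + b))) ≤
      finrank K (LinearMap.ker (f ^ a)) + finrank K (LinearMap.ker (f ^ b)) := by
  have hmem : ∀ x ∈ LinearMap.ker (f ^ (a + b)), (f ^ b) x ∈ LinearMap.ker (f ^ a) := by
    intro x hx
    rwa [LinearMap.mem_ker, ← Module.End.mul_apply, ← pow_add]
  have h1 := ((f ^ b).restrict hmem).finrank_range_add_finrank_ker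
  have h2 : finrank K (LinearMap.range ((f ^ b).restrict hmem)) ≤
      finrank K (LinearMap.ker (f ^ a)) := Submodule.finrank_le _
  have h3 : finrank K (LinearMap.ker ((f ^ b).restrict hmem)) ≤
      finrank K (LinearMap.ker (f ^ b)) := by
    let ι : LinearMap.ker ((f ^ b).restrict hmem) →ₗ[K] LinearMap.ker (f ^ b) :=
      LinearMap.codRestrict _
        ((LinearMap.ker (f ^ (a + b))).subtype ∘ₗ Submodule.subtype _)
        fun x => congrArg Subtype.val x.2
    refine LinearMap.finrank_le_finrank_of_injective (f := ι) fun x y hxy => ?_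
    exact Subtype.ext (Subtype.ext (congrArg (fun z : LinearMap.ker (f ^ b) => (z : M)) hxy))
  omega

lemma finrank_ker_pow_le {K M : Type*} [Field K] [AddCommGroup M] [Module K M]
    [FiniteDimensional K M] (f : M →ₗ[K] M) (k : ℕ) :
    finrank K (LinearMap.ker (f ^ k)) ≤ k * finrank K (LinearMap.ker f) := by
  induction k with
  | zero => simp [Module.End.one_eq_id]
  | succ k ih =>
    have := finrank_ker_pow_add_le f k 1
    rw [pow_one] at this
    rw [add_mul, one_mul]
    omega

/-- A nilpotent endomorphism with `f ^ p = 0` and as few Jordan blocks as possible has only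
blocks of size `p`. -/
lemma finrank_ker_pow_of_pow_eq_zero {K M : Type*} [Field K] [AddCommGroup M] [Module K M]
    [FiniteDimensional K M] {f : M →ₗ[K] M} {h p : ℕ} (hf : f ^ p = 0)
    (hM : finrank K M = h * p) (hker : finrank K (LinearMap.ker f) ≤ h) {k : ℕ} (hk : k ≤ p) :
    finrank K (LinearMap.ker (f ^ k)) = h * k := by
  obtain ⟨m, rfl⟩ := Nat.exists_eq_add_of_le hk
  have h1 := finrank_ker_pow_add_le f k m
  rw [hf, LinearMap.ker_zero, finrank_top, hM] at h1
  have h2 := (finrank_ker_pow_le f k).trans (Nat.mul_le_mul_left k hker)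
  have h3 := (finrank_ker_pow_le f m).trans (Nat.mul_le_mul_left m hker)
  nlinarith

lemma ker_pow_eq_range_pow {K M : Type*} [Field K] [AddCommGroup M] [Module K M]
    [FiniteDimensional K M] {f : M →ₗ[K] M} {h a b : ℕ} (hf : f ^ (a + b) = 0)
    (hM : finrank K M = h * (a + b)) (hker : finrank K (LinearMap.ker f) ≤ h) :
    LinearMap.ker (f ^ a) = LinearMap.range (f ^ b) := by
  symm
  apply Submodule.eq_of_le_of_finrank_eq
  · rintro _ ⟨x, rfl⟩
    rw [LinearMap.mem_ker, ← Module.End.mul_apply, ← pow_add, hf, LinearMap.zero_apply]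
  · have h1 := (f ^ b).finrank_range_add_finrank_ker
    rw [finrank_ker_pow_of_pow_eq_zero hf hM hker (Nat.le_add_left b a), hM] at h1
    rw [finrank_ker_pow_of_pow_eq_zero hf hM hker (Nat.le_add_right a b)]
    nlinarith

lemma finrank_comap_of_le_range {K M M' : Type*} [Field K] [AddCommGroup M] [Module K M]
    [FiniteDimensional K M] [AddCommGroup M'] [Module K M'] (f : M →ₗ[K] M')
    {W : Submodule K M'} (hW : W ≤ LinearMap.range f) :
    finrank K (W.comap f) = finrank K W + finrank K (LinearMap.ker f) := by
  have h1 := (f.domRestrict (W.comap f)).finrank_range_add_finrank_ker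
  rw [LinearMap.range_domRestrict, Submodule.map_comap_eq, inf_eq_right.2 hW,
    LinearMap.ker_domRestrict] at h1
  have hle : LinearMap.ker f ≤ W.comap f := fun x hx => by
    rw [Submodule.mem_comap, LinearMap.mem_ker.1 hx]; exact W.zero_mem
  rw [← h1, (Submodule.comapSubtypeEquivOfLe hle).finrank_eq]

/-- In characteristic `p`, `(a - 1) ^ (p - 1) = 1 + a + ⋯ + a ^ (p - 1)`. -/
lemma sub_one_pow_char_sub_one (K : Type*) [Field K] {p : ℕ} (hp : p.Prime) [CharP K p]
    {A : Type*} [Ring A] [Algebra K A] (a : A) :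
    (a - 1) ^ (p - 1) = ∑ i ∈ Finset.range p, a ^ i := by
  have := Fact.mk hp
  have key : ((Polynomial.X : Polynomial K) - 1) ^ (p - 1) =
      ∑ i ∈ Finset.range p, Polynomial.X ^ i := by
    have hX : (Polynomial.X : Polynomial K) - 1 ≠ 0 := by
      simpa using Polynomial.X_sub_C_ne_zero (1 : K)
    apply mul_right_cancel₀ hX
    rw [geom_sum_mul, ← pow_succ, Nat.sub_add_cancel hp.one_le, sub_pow_char, one_pow]
  simpa using congrArg (Polynomial.aeval a) key

lemma permMap_pow_apply (K : Type*) [Field K] {d : ℕ} (σ : Equiv.Perm (Fin d)) (i : ℕ)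
    (v : Fin d → K) (x : Fin d) : (permMap K σ ^ i) v x = v ((σ ^ i) x) := by
  induction i generalizing v with
  | zero => rfl
  | succ i ih =>
    rw [pow_succ, Module.End.mul_apply, ih, pow_succ']
    rfl

/-- A permutation of prime order without fixed points has a transversal of its cycles. -/
lemma exists_cycle_transversal {α : Type*} [Fintype α] [DecidableEq α] {p : ℕ} (hp : p.Prime)
    {σ : Equiv.Perm α} (hσp : σ ^ p = 1) (hfix : ∀ x, σ x ≠ x) :
    ∃ T : Finset α, ∀ x, ∃! i, i ∈ Finset.range p ∧ (σ ^ i) x ∈ T := by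
  classical
  have := Fact.mk hp
  let s := Equiv.Perm.SameCycle.setoid σ
  refine ⟨Finset.univ.image fun q : Quotient s => q.out, fun x => ?_⟩
  have hmem : ∀ y, y ∈ Finset.univ.image (fun q : Quotient s => q.out) ↔
      (Quotient.mk s y).out = y := by
    intro y
    simp only [Finset.mem_image, Finset.mem_univ, true_and]
    refine ⟨?_, fun h => ⟨_, h⟩⟩
    rintro ⟨q, rfl⟩
    rw [Quotient.out_eq]
  have hmk : ∀ i : ℕ, Quotient.mk s ((σ ^ i) x) = Quotient.mk s x := fun i =>
    Quotient.sound (show σ.SameCycle _ _ from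
      Equiv.Perm.sameCycle_pow_left.2 (Equiv.Perm.SameCycle.refl σ x))
  have hord : orderOf σ = p := orderOf_eq_prime hσp fun h => hfix x (by simp [h])
  have hper : Function.minimalPeriod σ x = p := by
    apply Function.minimalPeriod_eq_prime
    · change σ^[p] x = x
      rw [Equiv.Perm.iterate_eq_pow, hσp, Equiv.Perm.one_apply]
    · exact hfix x
  obtain ⟨i, hi, hix⟩ : ∃ i < p, (σ ^ i) x = (Quotient.mk s x).out := by
    have hsc : σ.SameCycle x (Quotient.mk s x).out := (Quotient.mk_out (s := s) x).symm
    simpa only [hord] using hsc.exists_pow_eq'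
  refine ⟨i, ⟨Finset.mem_range.2 hi, ?_⟩, ?_⟩
  · rw [hmem, hmk, hix]
  · rintro j ⟨hj, hjx⟩
    rw [hmem, hmk, ← hix] at hjx
    rw [Finset.mem_range] at hj
    refine Function.iterate_injOn_Iio_minimalPeriod (f := σ) (x := x) ?_ ?_ ?_
    · rwa [Set.mem_Iio, hper]
    · rwa [Set.mem_Iio, hper]
    · simpa [Equiv.Perm.iterate_eq_pow] using hjx.symm

/-- A set meeting each cycle once has an indicator function summing to `1` along each cycle. -/
lemma sum_range_indicator_pow_apply (R : Type*) [Semiring R] {α : Type*} [DecidableEq α] {p : ℕ}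
    {σ : Equiv.Perm α} {T : Finset α} {x : α}
    (hT : ∃! i, i ∈ Finset.range p ∧ (σ ^ i) x ∈ T) :
    ∑ i ∈ Finset.range p, (if (σ ^ i) x ∈ T then (1 : R) else 0) = 1 := by
  obtain ⟨i, ⟨hi, hix⟩, huniq⟩ := hT
  rw [Finset.sum_eq_single_of_mem i hi, if_pos hix]
  intro j hj hji
  exact if_neg fun hjx => hji (huniq j ⟨hj, hjx⟩)

lemma finrank_constSub (K : Type*) [Field K] {d : ℕ} (hd : 0 < d) :
    finrank K (constSub K d) = 1 :=
  finrank_span_singleton fun h => one_ne_zero (congrFun h ⟨0, hd⟩)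

lemma finrank_zeroSum (K : Type*) [Field K] {d : ℕ} (hd : 0 < d) :
    finrank K (zeroSum K d) + 1 = d := by
  have h1 := (sumFunctional K d).finrank_range_add_finrank_ker
  have h2 : LinearMap.range (sumFunctional K d) = ⊤ := by
    rw [LinearMap.range_eq_top]
    intro c
    exact ⟨Pi.single ⟨0, hd⟩ c, by simp [sumFunctional]⟩
  rw [h2, finrank_top, finrank_self, finrank_fin_fun] at h1
  rw [zeroSum]
  omega

lemma permMap_sub_one_apply_mem_zeroSum (K : Type*) [Field K] {d : ℕ}
    (σ : Equiv.Perm (Fin d)) (v : Fin d → K) : (permMap K σ - 1) v ∈ zeroSum K d := by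
  rw [zeroSum, LinearMap.mem_ker, LinearMap.sub_apply, map_sub, sub_eq_zero]
  exact Equiv.sum_comp σ v

lemma range_pow_le_zeroSum (K : Type*) [Field K] {d : ℕ} (σ : Equiv.Perm (Fin d)) {m : ℕ}
    (hm : m ≠ 0) : LinearMap.range ((permMap K σ - 1) ^ m) ≤ zeroSum K d := by
  rintro _ ⟨v, rfl⟩
  obtain ⟨m, rfl⟩ := Nat.exists_eq_succ_of_ne_zero hm
  rw [pow_succ', Module.End.mul_apply]
  exact permMap_sub_one_apply_mem_zeroSum K σ _

lemma permEnd_sub_id_pow_mk (K : Type*) [Field K] {d : ℕ} (σ : Equiv.Perm (Fin d)) (k : ℕ)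
    (u : zeroSum K d) : ∃ w : zeroSum K d, (w : Fin d → K) = ((permMap K σ - 1) ^ k) u ∧
      ((permEnd K σ - LinearMap.id) ^ k : Module.End K (deletedPermModule K d))
        ((UW K d).mkQ u) = (UW K d).mkQ w := by
  induction k with
  | zero => exact ⟨u, rfl, rfl⟩
  | succ k ih =>
    obtain ⟨w, hw, hw'⟩ := ih
    refine ⟨⟨(permMap K σ - 1) w, permMap_sub_one_apply_mem_zeroSum K σ _⟩, ?_, ?_⟩
    · rw [pow_succ', Module.End.mul_apply, hw]
    · rw [pow_succ', Module.End.mul_apply, hw']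
      rfl

/-- The kernel of `(g - 1) ^ k` on `U / W` is the preimage of `W` in `U`, modulo `W`. -/
lemma finrank_ker_permEnd_sub_id_pow (K : Type*) [Field K] {d : ℕ} (hd : 0 < d)
    (hW : constSub K d ≤ zeroSum K d) (σ : Equiv.Perm (Fin d)) (k : ℕ) :
    finrank K (LinearMap.ker ((permEnd K σ - LinearMap.id) ^ k)) + 1 =
      finrank K ↥(zeroSum K d ⊓ (constSub K d).comap ((permMap K σ - 1) ^ k)) := by
  set L := LinearMap.ker ((permEnd K σ - LinearMap.id) ^ k)
  have h1 := finrank_comap_of_le_range (K := K) (UW K d).mkQ (W := L)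
    ((UW K d).range_mkQ ▸ le_top)
  have h2 : finrank K (UW K d) = 1 := by
    rw [UW, inf_eq_right.2 hW, ← finrank_constSub K hd]
    exact (Submodule.comapSubtypeEquivOfLe hW).finrank_eq
  rw [Submodule.ker_mkQ, h2] at h1
  suffices hmap : (L.comap (UW K d).mkQ).map (zeroSum K d).subtype =
      zeroSum K d ⊓ (constSub K d).comap ((permMap K σ - 1) ^ k) by
    rw [← h1, ← Submodule.finrank_map_subtype_eq, hmap]
  ext v
  have key : ∀ hv : v ∈ zeroSum K d, (⟨v, hv⟩ : zeroSum K d) ∈ L.comap (UW K d).mkQ ↔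
      ((permMap K σ - 1) ^ k) v ∈ constSub K d := by
    intro hv
    obtain ⟨w, hw, hw'⟩ := permEnd_sub_id_pow_mk K σ k ⟨v, hv⟩
    rw [Submodule.mem_comap, LinearMap.mem_ker, hw', Submodule.mkQ_apply,
      Submodule.Quotient.mk_eq_zero, UW, inf_eq_right.2 hW, Submodule.mem_comap,
      Submodule.subtype_apply, hw]
  constructor
  · rintro ⟨⟨v, hv⟩, hvL, rfl⟩
    exact ⟨hv, (key hv).1 hvL⟩
  · rintro ⟨hv, hvW⟩
    exact ⟨⟨v, hv⟩, (key hv).2 hvW, rfl⟩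

/-- Lemma 3.2(iv): if `char K = p`, `d = hp` with `h ≥ 3` and `p ∣ h`, and `σ ∈ S_d` has
cycle type consisting of `h` cycles of length `p` (so `σ` is fixed-point-free), then the
induced endomorphism `g` of the fully deleted permutation module has Jordan form
`[J_p^{h-2}, J_{p-1}^2]`, i.e. `dim ker (g - 1)^k = (h-2)·min(k,p) + 2·min(k,p-1)`. -/
theorem stmt_15 (p : ℕ) (hp : p.Prime) (K : Type*) [Field K] [CharP K p]
    (d h : ℕ) (hh : 3 ≤ h) (hd : d = h * p) (hph : p ∣ h)
    (σ : Equiv.Perm (Fin d)) (hσ : σ.cycleType = Multiset.replicate h p) (k : ℕ) :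
    Module.finrank K (LinearMap.ker ((permEnd K σ - LinearMap.id) ^ k)) =
      (h - 2) * min k p + 2 * min k (p - 1) := by
  have hd0 : 0 < d := hd ▸ Nat.mul_pos (by omega) hp.pos
  have hh0 : (h : K) = 0 := (CharP.cast_eq_zero_iff K p h).2 hph
  have hW : constSub K d ≤ zeroSum K d := by
    rw [constSub, Submodule.span_singleton_le_iff_mem, zeroSum, LinearMap.mem_ker]
    simp [sumFunctional, hd, hh0]
  have hσp : σ ^ p = 1 := by
    rw [← orderOf_dvd_iff_pow_eq_one, ← Equiv.Perm.lcm_cycleType, Multiset.lcm_dvd, hσ]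
    intro b hb
    rw [Multiset.eq_of_mem_replicate hb]
  have hfix : ∀ x, σ x ≠ x := by
    have hs : σ.support = Finset.univ := by
      rw [← Finset.card_eq_iff_eq_univ, ← Equiv.Perm.sum_cycleType, hσ]
      simp [hd]
    intro x
    rw [← Equiv.Perm.mem_support, hs]
    exact Finset.mem_univ x
  obtain ⟨T, hT⟩ := exists_cycle_transversal hp hσp hfix
  let w : Fin d → K := fun x => if x ∈ T then 1 else 0
  have hcard : T.card = h := by
    have h1 : ∑ x : Fin d, ∑ i ∈ Finset.range p, (if (σ ^ i) x ∈ T then 1 else 0) = d := by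
      rw [Finset.sum_congr rfl fun x _ => sum_range_indicator_pow_apply ℕ (hT x)]
      simp
    rw [Finset.sum_comm] at h1
    have h2 : ∀ i, ∑ x : Fin d, (if (σ ^ i) x ∈ T then 1 else 0) = T.card := by
      intro i
      rw [Equiv.sum_comp (σ ^ i) (fun x => if x ∈ T then 1 else 0)]
      simp
    simp only [h2, Finset.sum_const, Finset.card_range, smul_eq_mul] at h1
    exact Nat.eq_of_mul_eq_mul_left hp.pos (h1.trans (hd.trans (mul_comm h p)))
  have hwU : w ∈ zeroSum K d := by
    simp [zeroSum, sumFunctional, w, hcard, hh0]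
  set N : (Fin d → K) →ₗ[K] (Fin d → K) := permMap K σ - 1 with hN
  have hw : (N ^ (p - 1)) w = fun _ => 1 := by
    funext x
    rw [hN, sub_one_pow_char_sub_one K hp, LinearMap.sum_apply, Finset.sum_apply]
    simp only [permMap_pow_apply]
    exact sum_range_indicator_pow_apply K (hT x)
  have hNp : N ^ p = 0 := by
    rw [← Nat.sub_add_cancel hp.one_le, pow_succ', hN, sub_one_pow_char_sub_one K hp, mul_geom_sum,
      sub_eq_zero]
    refine LinearMap.ext fun v => funext fun x => ?_
    rw [permMap_pow_apply, hσp]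
    rfl
  have hker : finrank K (LinearMap.ker N) ≤ h := by
    have hinv : ∀ v ∈ LinearMap.ker N, ∀ i x, v ((σ ^ i) x) = v x := by
      intro v hv i x
      have hv1 : permMap K σ v = v := sub_eq_zero.1 hv
      rw [← permMap_pow_apply K σ i v x, Module.End.pow_apply, Function.iterate_fixed hv1]
    have hinj : Function.Injective
        ((LinearMap.funLeft K K (Subtype.val : T → Fin d)).domRestrict (LinearMap.ker N)) := by
      rw [← LinearMap.ker_eq_bot, LinearMap.ker_eq_bot']
      rintro ⟨v, hv⟩ hv0
      refine Subtype.ext (funext fun x => ?_)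
      obtain ⟨i, ⟨-, hi⟩, -⟩ := hT x
      refine (hinv v hv i x).symm.trans ?_
      exact congrFun hv0 ⟨_, hi⟩
    simpa [hcard] using LinearMap.finrank_le_finrank_of_injective hinj
  have hM : finrank K (Fin d → K) = h * p := by rw [finrank_fin_fun, hd]
  have key := finrank_ker_permEnd_sub_id_pow K hd0 hW σ k
  rw [← hN] at key
  obtain ⟨n, rfl⟩ := Nat.exists_eq_add_of_le' (show 2 ≤ h by omega)
  obtain hk | hk := le_or_gt p k
  · have h0 : N ^ k = 0 := pow_eq_zero_of_le hk hNp
    have h1 := finrank_zeroSum K hd0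
    rw [h0, Submodule.comap_zero, inf_top_eq] at key
    rw [min_eq_right hk, min_eq_right (by omega), Nat.add_sub_cancel]
    have := hp.pos
    rw [add_mul] at hd
    omega
  · obtain ⟨m, hm⟩ := Nat.exists_eq_add_of_le (Nat.le_sub_one_of_lt hk)
    have hpkm : p = k + (m + 1) := by omega
    have hone : (N ^ k) ((N ^ m) w) = fun _ => 1 := by
      rw [← Module.End.mul_apply, ← pow_add, ← hm, hw]
    have hle : constSub K d ≤ LinearMap.range (N ^ k) := by
      rw [constSub, Submodule.span_singleton_le_iff_mem]
      exact ⟨_, hone⟩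
    have hNw : (N ^ m) w ∈ zeroSum K d := by
      obtain rfl | hm0 := eq_or_ne m 0
      · simpa using hwU
      · exact range_pow_le_zeroSum K σ hm0 ⟨w, rfl⟩
    have hcomap : (constSub K d).comap (N ^ k) ≤ zeroSum K d := by
      intro v hv
      obtain ⟨c, hc⟩ := Submodule.mem_span_singleton.1 hv
      have hdiff : v - c • (N ^ m) w ∈ LinearMap.ker (N ^ k) := by
        rw [LinearMap.mem_ker, map_sub, map_smul, hone, hc, sub_self]
      rw [ker_pow_eq_range_pow (hpkm ▸ hNp) (hpkm ▸ hM) hker] at hdiff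
      have := range_pow_le_zeroSum K σ m.succ_ne_zero hdiff
      simpa using add_mem this (Submodule.smul_mem _ c hNw)
    rw [inf_eq_right.2 hcomap, finrank_comap_of_le_range _ hle, finrank_constSub K hd0,
      finrank_ker_pow_of_pow_eq_zero hNp hM hker hk.le] at key
    rw [min_eq_left hk.le, min_eq_left (by omega), Nat.add_sub_cancel, ← add_mul]
    omega
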